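/- arXiv:2406.03913 — 4 statements merged into one kernel-verified Lean document; each statement's English description precedes it below -/
import Mathlib

section
/- For real exponents q ≥ p ≥ 1 and real numbers α, β ≥ 0 (with the convention 0^0 = 1), the inequality (1/q)(α^q − β^q) ≥ β^{q−p} · (1/p)(α^p − β^p) holds. -/
/-- For real exponents `q ≥ p ≥ 1` and reals `α, β ≥ 0` (real powers, with `0^0 = 1`),
`(1/q)(α^q − β^q) ≥ β^(q−p) · (1/p)(α^p − β^p)`. -/
theorem power_gap_inequality (p q α β : ℝ) (hp : 1 ≤ p) (hpq : p ≤ q)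
    (hα : 0 ≤ α) (hβ : 0 ≤ β) :
    β ^ (q - p) * ((α ^ p - β ^ p) / p) ≤ (α ^ q - β ^ q) / q := by
  have hp0 : 0 < p := by linarith
  have hq0 : 0 < q := by linarith
  have hd : 0 ≤ q - p := sub_nonneg.2 hpq
  have hβq : β ^ (q - p) * β ^ p = β ^ q := by
    rw [← Real.rpow_add_of_nonneg hβ hd hp0.le, sub_add_cancel]
  have amgm := Real.geom_mean_le_arith_mean2_weighted (div_nonneg hp0.le hq0.le)
    (div_nonneg hd hq0.le) (Real.rpow_nonneg hα q) (Real.rpow_nonneg hβ q)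
    (by field_simp; ring)
  rw [← Real.rpow_mul hα, ← Real.rpow_mul hβ, mul_div_cancel₀ _ hq0.ne',
    mul_div_cancel₀ _ hq0.ne'] at amgm
  calc β ^ (q - p) * ((α ^ p - β ^ p) / p)
      = (α ^ p * β ^ (q - p) - β ^ q) / p := by rw [← hβq]; ring
    _ ≤ (p / q * α ^ q + (q - p) / q * β ^ q - β ^ q) / p := by gcongr
    _ = (α ^ q - β ^ q) / q := by field_simp; ring
end

section
/- Let E be a real Hilbert space, A a nonempty finite subset of E, and x̄ ∈ E. Then the following are equivalent: (i) x̄ is A-minimal; (ii) x̄ is strongly A-minimal; (iii) x̄ is A-Pareto. -/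
/-- The midpoint of two distinct points `x`, `y` is strictly closer to `a` than `y` as soon as `x`
is at least as close to `a` as `y`. -/
theorem norm_midpoint_sub_lt_of_norm_sub_le {E : Type*} [NormedAddCommGroup E]
    [InnerProductSpace ℝ E] {x y a : E} (hne : x ≠ y) (h : ‖x - a‖ ≤ ‖y - a‖) :
    ‖midpoint ℝ x y - a‖ < ‖y - a‖ := by
  have hmid : midpoint ℝ x y - a = (2⁻¹ : ℝ) • ((x - a) + (y - a)) := by
    rw [midpoint_eq_smul_add, invOf_eq_inv]
    module
  have hpar := parallelogram_law_with_norm ℝ (x - a) (y - a)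
  have hpos : 0 < ‖x - y‖ := norm_pos_iff.2 (sub_ne_zero.2 hne)
  rw [sub_sub_sub_cancel_right] at hpar
  rw [hmid, norm_smul, Real.norm_of_nonneg (by norm_num)]
  nlinarith [norm_nonneg (x - a), norm_nonneg (y - a), norm_nonneg ((x - a) + (y - a))]

/-- In a real Hilbert space, for a nonempty finite set `A` and a point `xbar`, the properties
`A`-minimal, strongly `A`-minimal, and `A`-Pareto are equivalent
(here `d(a,x) = ‖x − a‖`). -/
theorem aMinimal_stronglyAMinimal_aPareto_equiv {E : Type*} [NormedAddCommGroup E]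
    [InnerProductSpace ℝ E] [CompleteSpace E] (A : Finset E) (hA : A.Nonempty) (xbar : E) :
    ((¬ ∃ x : E, ∀ a ∈ A, ‖x - a‖ < ‖xbar - a‖) ↔
      (¬ ∃ x : E, x ≠ xbar ∧ ∀ a ∈ A, ‖x - a‖ ≤ ‖xbar - a‖)) ∧
    ((¬ ∃ x : E, ∀ a ∈ A, ‖x - a‖ < ‖xbar - a‖) ↔
      (∀ x : E, (∀ a ∈ A, ‖x - a‖ ≤ ‖xbar - a‖) → ∀ a ∈ A, ‖x - a‖ = ‖xbar - a‖)) := by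
  have strong : (¬ ∃ x : E, ∀ a ∈ A, ‖x - a‖ < ‖xbar - a‖) →
      ¬ ∃ x : E, x ≠ xbar ∧ ∀ a ∈ A, ‖x - a‖ ≤ ‖xbar - a‖ := fun hmin ⟨x, hne, hx⟩ =>
    hmin ⟨midpoint ℝ x xbar, fun a ha => norm_midpoint_sub_lt_of_norm_sub_le hne (hx a ha)⟩
  have pareto : (¬ ∃ x : E, x ≠ xbar ∧ ∀ a ∈ A, ‖x - a‖ ≤ ‖xbar - a‖) →
      ∀ x : E, (∀ a ∈ A, ‖x - a‖ ≤ ‖xbar - a‖) → ∀ a ∈ A, ‖x - a‖ = ‖xbar - a‖ := by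
    intro hs x hx a _
    have hxx : x = xbar := by_contra fun hne => hs ⟨x, hne, hx⟩
    rw [hxx]
  have minimal : (∀ x : E, (∀ a ∈ A, ‖x - a‖ ≤ ‖xbar - a‖) → ∀ a ∈ A, ‖x - a‖ = ‖xbar - a‖) →
      ¬ ∃ x : E, ∀ a ∈ A, ‖x - a‖ < ‖xbar - a‖ := by
    rintro hp ⟨x, hx⟩
    obtain ⟨a, ha⟩ := hA
    exact (hx a ha).ne (hp x (fun b hb => (hx b hb).le) a ha)
  exact ⟨⟨strong, minimal ∘ pareto⟩, ⟨pareto ∘ strong, minimal⟩⟩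
end

section
/- Let E be a real Hilbert space, A a nonempty finite subset of E, and x̄ ∈ E. Then the test function f_{A,x̄} has a unique minimizer x̂ over E, and x̂ is the nearest point to x̄ in the convex hull of A: x̂ lies in the convex hull of A and ‖x̄ − x̂‖ ≤ ‖x̄ − z‖ for every z in the convex hull of A. -/
/-- The test function `f_{A,xbar}(x) = (1/2)·max_{a∈A} (‖x − a‖² − ‖xbar − a‖²)`. -/
noncomputable def testFun {E : Type*} [NormedAddCommGroup E] [InnerProductSpace ℝ E]
    (A : Finset E) (hA : A.Nonempty) (xbar x : E) : ℝ :=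
  (1 / 2 : ℝ) * A.sup' hA (fun a => ‖x - a‖ ^ 2 - ‖xbar - a‖ ^ 2)

/-- Some point of `A` witnesses a lower bound of the maximum in `testFun` by its affine
interpolation at a point of the convex hull. -/
lemma le_testFun_of_mem_convexHull {E : Type*} [NormedAddCommGroup E] [InnerProductSpace ℝ E]
    (A : Finset E) (hA : A.Nonempty) (xbar x : E) {p : E} (hp : p ∈ convexHull ℝ (A : Set E)) :
    (1 / 2 : ℝ) * (‖x - p‖ ^ 2 - ‖xbar - p‖ ^ 2) ≤ testFun A hA xbar x := by
  obtain ⟨a, ha, hap⟩ := ((innerₛₗ ℝ (x - xbar)).concaveOn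
    (convex_convexHull ℝ (A : Set E))).exists_le_of_mem_convexHull
    (subset_convexHull ℝ (A : Set E)) hp
  have hle := A.le_sup' (fun a => ‖x - a‖ ^ 2 - ‖xbar - a‖ ^ 2) (Finset.mem_coe.1 ha)
  simp only [innerₛₗ_apply_apply, inner_sub_left] at hap
  simp only [testFun, norm_sub_sq_real] at hle ⊢
  linarith

/-- If `p` satisfies the variational inequality of the projection of `xbar` onto the convex hull
of `A`, then `testFun` is at most `-‖xbar - p‖ ^ 2 / 2` at `p`. -/
lemma testFun_le_of_inner_nonpos {E : Type*} [NormedAddCommGroup E] [InnerProductSpace ℝ E]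
    (A : Finset E) (hA : A.Nonempty) (xbar : E) {p : E}
    (hp : ∀ a ∈ A, inner ℝ (xbar - p) (a - p) ≤ 0) :
    testFun A hA xbar p ≤ -((1 / 2 : ℝ) * ‖xbar - p‖ ^ 2) := by
  have hsup : A.sup' hA (fun a => ‖p - a‖ ^ 2 - ‖xbar - a‖ ^ 2) ≤ -‖xbar - p‖ ^ 2 := by
    refine Finset.sup'_le _ _ fun a ha => ?_
    have h := norm_sub_sq_real (xbar - p) (a - p)
    rw [sub_sub_sub_cancel_right, norm_sub_rev a p] at h
    linarith [hp a ha]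
  rw [testFun]
  linarith

/-- In a real Hilbert space, the test function `f_{A,xbar}` has a unique minimizer `xhat`,
which is the nearest point to `xbar` in the convex hull of `A`. -/
theorem testFun_unique_minimizer_is_projection {E : Type*} [NormedAddCommGroup E]
    [InnerProductSpace ℝ E] [CompleteSpace E] (A : Finset E) (hA : A.Nonempty) (xbar : E) :
    ∃ xhat : E,
      (∀ x : E, testFun A hA xbar xhat ≤ testFun A hA xbar x) ∧
      (∀ x : E, (∀ y : E, testFun A hA xbar x ≤ testFun A hA xbar y) → x = xhat) ∧
      xhat ∈ convexHull ℝ (A : Set E) ∧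
      ∀ z ∈ convexHull ℝ (A : Set E), ‖xbar - xhat‖ ≤ ‖xbar - z‖ := by
  obtain ⟨p, hp, hmin⟩ := exists_norm_eq_iInf_of_complete_convex
    (hA.to_set.convexHull (𝕜 := ℝ)) (A.finite_toSet.isClosed_convexHull ℝ).isComplete
    (convex_convexHull ℝ (A : Set E)) xbar
  have hinner := (norm_eq_iInf_iff_real_inner_le_zero
    (convex_convexHull ℝ (A : Set E)) hp).1 hmin
  have hub := testFun_le_of_inner_nonpos A hA xbar
    fun a ha => hinner a (subset_convexHull ℝ _ (Finset.mem_coe.2 ha))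
  have hlb := fun x => le_testFun_of_mem_convexHull A hA xbar x hp
  refine ⟨p, fun x => ?_, fun x hx => ?_, hp, fun z hz => ?_⟩
  · linarith [hlb x, sq_nonneg ‖x - p‖]
  · have hsq : ‖x - p‖ ^ 2 ≤ 0 := by linarith [hlb x, hx p]
    exact sub_eq_zero.1 (norm_eq_zero.1 (pow_eq_zero_iff two_ne_zero |>.1
      (le_antisymm hsq (sq_nonneg _))))
  · rw [hmin]
    exact ciInf_le ⟨0, Set.forall_mem_range.2 fun _ => norm_nonneg _⟩
      (⟨z, hz⟩ : convexHull ℝ (A : Set E))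
end

section
/- Let E be a real Hilbert space, A a nonempty finite subset of E, and x̄ ∈ E. Let x̂ be the nearest point to x̄ in the convex hull of A, and suppose x̂ ≠ x̄. Then for every t ∈ (0,1] and every a ∈ A, ‖(t·x̂ + (1−t)·x̄) − a‖ < ‖x̄ − a‖; in particular every point of the half-open segment (x̄, x̂] certifies that x̄ is not A-minimal. -/
open scoped RealInnerProductSpace

/-- The variational inequality for a nearest point `v` to `u` in a convex set. -/
theorem inner_sub_sub_nonpos_of_nearest {E : Type*} [NormedAddCommGroup E]
    [InnerProductSpace ℝ E] {K : Set E} (hK : Convex ℝ K) {u v w : E} (hv : v ∈ K)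
    (hnear : ∀ z ∈ K, ‖u - v‖ ≤ ‖u - z‖) (hw : w ∈ K) : ⟪u - v, w - v⟫ ≤ 0 := by
  have : Nonempty K := ⟨⟨v, hv⟩⟩
  refine (norm_eq_iInf_iff_real_inner_le_zero hK hv).mp (le_antisymm ?_ ?_) w hw
  · exact le_ciInf fun z => hnear z z.2
  · exact ciInf_le ⟨0, Set.forall_mem_range.mpr fun z : K => norm_nonneg (u - z)⟩ ⟨v, hv⟩

/-- If `a` lies in the half-space through `v` orthogonal to `u - v` and opposite to `u`, then
moving from `u` towards `v` strictly decreases the distance to `a`. -/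
theorem norm_segment_sub_lt {E : Type*} [NormedAddCommGroup E] [InnerProductSpace ℝ E]
    {u v a : E} (h : ⟪u - v, a - v⟫ ≤ 0) (hne : v ≠ u) {t : ℝ} (ht : t ∈ Set.Ioc (0 : ℝ) 1) :
    ‖(t • v + (1 - t) • u) - a‖ < ‖u - a‖ := by
  have hpos : 0 < ‖u - v‖ ^ 2 := pow_pos (norm_sub_pos_iff.mpr hne.symm) 2
  have hleft : (t • v + (1 - t) • u) - a = (1 - t) • (u - v) - (a - v) := by module
  have hright : u - a = (u - v) - (a - v) := by abel
  refine lt_of_pow_lt_pow_left₀ 2 (norm_nonneg _) ?_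
  rw [hleft, hright, norm_sub_sq_real, norm_sub_sq_real (u - v), real_inner_smul_left, norm_smul,
    mul_pow, Real.norm_eq_abs, sq_abs]
  obtain ⟨ht0, ht1⟩ := ht
  have hgain : 0 < t * (2 - t) * ‖u - v‖ ^ 2 := mul_pos (mul_pos ht0 (by linarith)) hpos
  nlinarith [mul_nonpos_of_nonneg_of_nonpos ht0.le h]

/-- In a real Hilbert space, if `xhat` is the nearest point to `xbar` in the convex hull of a
nonempty finite set `A` and `xhat ≠ xbar`, then every point `t·xhat + (1−t)·xbar` with
`t ∈ (0,1]` is strictly closer than `xbar` to every point of `A`; in particular every point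
of the half-open segment `(xbar, xhat]` certifies that `xbar` is not `A`-minimal. -/
theorem segment_certifies_not_aMinimal {E : Type*} [NormedAddCommGroup E]
    [InnerProductSpace ℝ E] [CompleteSpace E] (A : Finset E) (hA : A.Nonempty)
    (xbar xhat : E) (hmem : xhat ∈ convexHull ℝ (A : Set E))
    (hnear : ∀ z ∈ convexHull ℝ (A : Set E), ‖xbar - xhat‖ ≤ ‖xbar - z‖)
    (hne : xhat ≠ xbar) :
    (∀ t : ℝ, t ∈ Set.Ioc (0 : ℝ) 1 → ∀ a ∈ A,
      ‖(t • xhat + (1 - t) • xbar) - a‖ < ‖xbar - a‖) ∧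
    ¬ (¬ ∃ x : E, ∀ a ∈ A, ‖x - a‖ < ‖xbar - a‖) := by
  have segment_closer : ∀ t : ℝ, t ∈ Set.Ioc (0 : ℝ) 1 → ∀ a ∈ A,
      ‖(t • xhat + (1 - t) • xbar) - a‖ < ‖xbar - a‖ := fun t ht a ha =>
    norm_segment_sub_lt (inner_sub_sub_nonpos_of_nearest (convex_convexHull ℝ _) hmem hnear
      (subset_convexHull ℝ _ ha)) hne ht
  exact ⟨segment_closer, not_not.mpr ⟨_, segment_closer 1 ⟨one_pos, le_rfl⟩⟩⟩
end
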